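/- Let γ : [0,1] → ℝ², γ = (u,v), be a C¹ closed curve (γ(0) = γ(1)) whose image is disjoint from all circles C_1,…,C_n and from all centers p_1,…,p_n. Then ∫₀¹ [−Q_{Tm}(γ(t)) u'(t) + P_{Tm}(γ(t)) v'(t)] / (A_m(γ(t)) B(γ(t))) dt = 2 Σ_{j=1}^r ∫₀¹ [(u(t)−x_j) v'(t) − (v(t)−y_j) u'(t)] / g_j(γ(t)) dt. -/

import Mathlib

open MvPolynomial Function Set Filter Real
open scoped Classical

noncomputable section

/-- Bivariate real polynomials, representing components of planar polynomial vector fields. -/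
abbrev Poly2 := MvPolynomial (Fin 2) ℝ

/-- Evaluation of a bivariate polynomial at a point of the plane. -/
def pev (P : Poly2) (p : ℝ × ℝ) : ℝ := MvPolynomial.eval ![p.1, p.2] P

/-- The circle polynomial `f(x,y) = (x−a)² + (y−b)² − ρ²`. -/
def fpoly (c : ℝ × ℝ) (ρ : ℝ) : Poly2 :=
  (X 0 - MvPolynomial.C c.1) ^ 2 + (X 1 - MvPolynomial.C c.2) ^ 2 - MvPolynomial.C (ρ ^ 2)

/-- The divergence `∂P/∂x + ∂Q/∂y` of the vector field `X = P ∂ₓ + Q ∂ᵧ`. -/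
def divPoly (P Q : Poly2) : Poly2 := pderiv 0 P + pderiv 1 Q

/-- `γ : ℝ → ℝ²` is a (C¹) solution of the vector field `X = P ∂ₓ + Q ∂ᵧ`. -/
def IsSolution (P Q : Poly2) (γ : ℝ → ℝ × ℝ) : Prop :=
  ∀ t, HasDerivAt γ (pev P (γ t), pev Q (γ t)) t

/-- `S` is a periodic orbit of `X = P ∂ₓ + Q ∂ᵧ`: the image of a nonconstant periodic solution. -/
def IsPeriodicOrbit (P Q : Poly2) (S : Set (ℝ × ℝ)) : Prop :=
  ∃ γ : ℝ → ℝ × ℝ, ∃ T : ℝ, 0 < T ∧ IsSolution P Q γ ∧ Function.Periodic γ T ∧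
    (∃ t₀ t₁, γ t₀ ≠ γ t₁) ∧ Set.range γ = S

/-- `S` is a limit cycle: a periodic orbit with a neighborhood meeting no other periodic orbit. -/
def IsLimitCycle (P Q : Poly2) (S : Set (ℝ × ℝ)) : Prop :=
  IsPeriodicOrbit P Q S ∧
  ∃ U : Set (ℝ × ℝ), IsOpen U ∧ S ⊆ U ∧
    ∀ S', IsPeriodicOrbit P Q S' → S' ≠ S → Disjoint S' U

/-- `T` is the least positive period of `γ`. -/
def IsLeastPeriod (γ : ℝ → ℝ × ℝ) (T : ℝ) : Prop :=
  0 < T ∧ Function.Periodic γ T ∧ ∀ T', 0 < T' → Function.Periodic γ T' → T ≤ T'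

/-- The (limit) cycle `S` has least period `T`: it is parametrized by a solution of least
period `T`. -/
def HasLeastPeriodCycle (P Q : Poly2) (S : Set (ℝ × ℝ)) (T : ℝ) : Prop :=
  ∃ γ : ℝ → ℝ × ℝ, IsSolution P Q γ ∧ Set.range γ = S ∧ IsLeastPeriod γ T

/-- `V` is a (polynomial) inverse integrating factor of `X = P ∂ₓ + Q ∂ᵧ`:
`P ∂V/∂x + Q ∂V/∂y = V (∂P/∂x + ∂Q/∂y)`. -/
def IsInvFactor (P Q V : Poly2) : Prop :=
  P * pderiv 0 V + Q * pderiv 1 V = V * divPoly P Q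

/-- An embedded closed curve in the plane: a set homeomorphic to the circle. -/
def IsCycle (S : Set (ℝ × ℝ)) : Prop :=
  Nonempty (S ≃ₜ Metric.sphere (0 : ℝ × ℝ) 1)

/-- The compact region `D_C` bounded by a closed curve `C`: the curve together with the
points of the complement whose connected component in the complement is bounded. -/
def encDisk (S : Set (ℝ × ℝ)) : Set (ℝ × ℝ) :=
  S ∪ {p | p ∉ S ∧ Bornology.IsBounded (connectedComponentIn Sᶜ p)}

/-- `C_k` is a primary cycle of the configuration `Γ`: no other `C_j` is contained in `D_{C_k}`. -/
def PrimaryCycle {n : ℕ} (Γ : Fin n → Set (ℝ × ℝ)) (k : Fin n) : Prop :=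
  ∀ j, j ≠ k → ¬ Γ j ⊆ encDisk (Γ k)

/-- The limit cycle `S`, with enclosed region `D`, is stable in the interior for
`X = P ∂ₓ + Q ∂ᵧ`: every solution starting in the bounded region enclosed by `S`
sufficiently close to `S` converges to `S` as `t → +∞`. -/
def InteriorStable (P Q : Poly2) (S D : Set (ℝ × ℝ)) : Prop :=
  ∃ U : Set (ℝ × ℝ), IsOpen U ∧ S ⊆ U ∧
    ∀ γ : ℝ → ℝ × ℝ, IsSolution P Q γ → γ 0 ∈ (D \ S) ∩ U →
      Filter.Tendsto (fun t => Metric.infDist (γ t) S) Filter.atTop (nhds 0)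

/-- The limit cycle `S`, with enclosed region `D`, is unstable in the interior:
every solution starting in the bounded region enclosed by `S` sufficiently close to `S`
converges to `S` as `t → −∞`. -/
def InteriorUnstable (P Q : Poly2) (S D : Set (ℝ × ℝ)) : Prop :=
  ∃ U : Set (ℝ × ℝ), IsOpen U ∧ S ⊆ U ∧
    ∀ γ : ℝ → ℝ × ℝ, IsSolution P Q γ → γ 0 ∈ (D \ S) ∩ U →
      Filter.Tendsto (fun t => Metric.infDist (γ t) S) Filter.atBot (nhds 0)

/-- The polynomial `g(x,y) = (x−a)² + (y−b)²`. -/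
def gpoly (c : ℝ × ℝ) : Poly2 :=
  (X 0 - MvPolynomial.C c.1) ^ 2 + (X 1 - MvPolynomial.C c.2) ^ 2

variable {n : ℕ}

/-- `f_k(x,y) = (x−x_k)² + (y−y_k)² − r_k²`. -/
def fk (ctr : Fin n → ℝ × ℝ) (rad : Fin n → ℝ) (k : Fin n) : Poly2 :=
  fpoly (ctr k) (rad k)

/-- The circle `C_k = f_k⁻¹(0)`. -/
def Ccir (ctr : Fin n → ℝ × ℝ) (rad : Fin n → ℝ) (k : Fin n) : Set (ℝ × ℝ) :=
  {p : ℝ × ℝ | pev (fk ctr rad k) p = 0}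

/-- The closed disc `D_{C_k}` bounded by the circle `C_k`. -/
def Ddisc (ctr : Fin n → ℝ × ℝ) (rad : Fin n → ℝ) (k : Fin n) : Set (ℝ × ℝ) :=
  {p : ℝ × ℝ | (p.1 - (ctr k).1) ^ 2 + (p.2 - (ctr k).2) ^ 2 ≤ (rad k) ^ 2}

/-- `C_k` is primary: no other circle `C_j` is contained in `D_{C_k}`. -/
def Primary (ctr : Fin n → ℝ × ℝ) (rad : Fin n → ℝ) (k : Fin n) : Prop :=
  ∀ j, j ≠ k → ¬ Ccir ctr rad j ⊆ Ddisc ctr rad k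

/-- `A = ∏_{k=1}^n f_k`. -/
def Apoly (ctr : Fin n → ℝ × ℝ) (rad : Fin n → ℝ) : Poly2 := ∏ k, fk ctr rad k

/-- `B = ∏_{k=1}^r g_k` (product over the primary indices, i.e. those with `k < r`). -/
def Bpoly (r : ℕ) (ctr : Fin n → ℝ × ℝ) : Poly2 :=
  ∏ k ∈ Finset.univ.filter (fun k : Fin n => (k : ℕ) < r), gpoly (ctr k)

/-- `μ_k = ∏_{j≠k} f_j`. -/
def muk (ctr : Fin n → ℝ × ℝ) (rad : Fin n → ℝ) (k : Fin n) : Poly2 :=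
  ∏ j ∈ Finset.univ.erase k, fk ctr rad j

/-- `P_T = A(∂B/∂x − ∂B/∂y) − B Σ_k τ_k μ_k ∂f_k/∂y`. -/
def PT (r : ℕ) (ctr : Fin n → ℝ × ℝ) (rad τ : Fin n → ℝ) : Poly2 :=
  Apoly ctr rad * (pderiv 0 (Bpoly r ctr) - pderiv 1 (Bpoly r ctr)) -
    Bpoly r ctr * ∑ k, MvPolynomial.C (τ k) * muk ctr rad k * pderiv 1 (fk ctr rad k)

/-- `Q_T = A(∂B/∂x + ∂B/∂y) + B Σ_k τ_k μ_k ∂f_k/∂x`. -/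
def QT (r : ℕ) (ctr : Fin n → ℝ × ℝ) (rad τ : Fin n → ℝ) : Poly2 :=
  Apoly ctr rad * (pderiv 0 (Bpoly r ctr) + pderiv 1 (Bpoly r ctr)) +
    Bpoly r ctr * ∑ k, MvPolynomial.C (τ k) * muk ctr rad k * pderiv 0 (fk ctr rad k)

/-- `N_k`: the number of circles `C_j`, `j ≠ k`, whose bounded disc contains `C_k`. -/
def Nk (ctr : Fin n → ℝ × ℝ) (rad : Fin n → ℝ) (k : Fin n) : ℕ :=
  Nat.card {j : Fin n // j ≠ k ∧ Ccir ctr rad k ⊆ Ddisc ctr rad j}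

/-- `s_k`: the number of primary circles contained in the closed disc `D_{C_k}`. -/
def sk (r : ℕ) (ctr : Fin n → ℝ × ℝ) (rad : Fin n → ℝ) (k : Fin n) : ℕ :=
  Nat.card {j : Fin n // (j : ℕ) < r ∧ Ccir ctr rad j ⊆ Ddisc ctr rad k}

/-- `λ_k = ∏_{j≠k} f_j^{m_j}`. -/
def lamk (ctr : Fin n → ℝ × ℝ) (rad : Fin n → ℝ) (m : Fin n → ℕ) (k : Fin n) : Poly2 :=
  ∏ j ∈ Finset.univ.erase k, fk ctr rad j ^ m j

/-- `Λ = Σ_k (m_k − 1)`. -/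
def Lam (m : Fin n → ℕ) : ℕ := ∑ k, (m k - 1)

/-- `A_m = ∏_k f_k^{m_k}`. -/
def Am (ctr : Fin n → ℝ × ℝ) (rad : Fin n → ℝ) (m : Fin n → ℕ) : Poly2 :=
  ∏ k, fk ctr rad k ^ m k

/-- `F_T = Λ Σ_k τ_k λ_k ∂f_k/∂y`. -/
def FTm (ctr : Fin n → ℝ × ℝ) (rad τ : Fin n → ℝ) (m : Fin n → ℕ) : Poly2 :=
  MvPolynomial.C ((Lam m : ℕ) : ℝ) *
    ∑ k, MvPolynomial.C (τ k) * lamk ctr rad m k * pderiv 1 (fk ctr rad k)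

/-- `G_T = Λ Σ_k τ_k λ_k ∂f_k/∂x`. -/
def GTm (ctr : Fin n → ℝ × ℝ) (rad τ : Fin n → ℝ) (m : Fin n → ℕ) : Poly2 :=
  MvPolynomial.C ((Lam m : ℕ) : ℝ) *
    ∑ k, MvPolynomial.C (τ k) * lamk ctr rad m k * pderiv 0 (fk ctr rad k)

/-- `P_{Tm} = P_T · ∏_k f_k^{m_k−1} − B F_T`. -/
def PTm (r : ℕ) (ctr : Fin n → ℝ × ℝ) (rad τ : Fin n → ℝ) (m : Fin n → ℕ) : Poly2 :=
  PT r ctr rad τ * ∏ k, fk ctr rad k ^ (m k - 1) - Bpoly r ctr * FTm ctr rad τ m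

/-- `Q_{Tm} = Q_T · ∏_k f_k^{m_k−1} + B G_T`. -/
def QTm (r : ℕ) (ctr : Fin n → ℝ × ℝ) (rad τ : Fin n → ℝ) (m : Fin n → ℕ) : Poly2 :=
  QT r ctr rad τ * ∏ k, fk ctr rad k ^ (m k - 1) + Bpoly r ctr * GTm ctr rad τ m

/-- `M_k = Σ_{j ≠ k, C_k ⊆ D_{C_j}} m_j`. -/
def Mk (ctr : Fin n → ℝ × ℝ) (rad : Fin n → ℝ) (m : Fin n → ℕ) (k : Fin n) : ℕ :=
  ∑ j ∈ Finset.univ.filter (fun j : Fin n => j ≠ k ∧ Ccir ctr rad k ⊆ Ddisc ctr rad j), m j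

section Evaluation

lemma pev_gpoly (c p : ℝ × ℝ) : pev (gpoly c) p = (p.1 - c.1) ^ 2 + (p.2 - c.2) ^ 2 := by
  simp [pev, gpoly]

lemma pev_fpoly (c : ℝ × ℝ) (ρ : ℝ) (p : ℝ × ℝ) :
    pev (fpoly c ρ) p = (p.1 - c.1) ^ 2 + (p.2 - c.2) ^ 2 - ρ ^ 2 := by
  simp [pev, fpoly]

lemma pev_pderiv_zero_gpoly (c p : ℝ × ℝ) :
    pev (pderiv 0 (gpoly c)) p = 2 * (p.1 - c.1) := by
  simp [pev, gpoly, pderiv_X]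

lemma pev_pderiv_one_gpoly (c p : ℝ × ℝ) :
    pev (pderiv 1 (gpoly c)) p = 2 * (p.2 - c.2) := by
  simp [pev, gpoly, pderiv_X]

lemma pev_pderiv_zero_fpoly (c : ℝ × ℝ) (ρ : ℝ) (p : ℝ × ℝ) :
    pev (pderiv 0 (fpoly c ρ)) p = 2 * (p.1 - c.1) := by
  simp [pev, fpoly, pderiv_X]

lemma pev_pderiv_one_fpoly (c : ℝ × ℝ) (ρ : ℝ) (p : ℝ × ℝ) :
    pev (pderiv 1 (fpoly c ρ)) p = 2 * (p.2 - c.2) := by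
  simp [pev, fpoly, pderiv_X]

lemma pev_gpoly_ne_zero {c p : ℝ × ℝ} (h : p ≠ c) : pev (gpoly c) p ≠ 0 := by
  rw [pev_gpoly]
  contrapose! h
  ext <;> nlinarith [sq_nonneg (p.1 - c.1), sq_nonneg (p.2 - c.2)]

/-- Logarithmic differentiation of a product of polynomials. -/
lemma pev_pderiv_prod {ι : Type*} (s : Finset ι) (F : ι → Poly2) (i : Fin 2) (p : ℝ × ℝ)
    (h : ∀ k ∈ s, pev (F k) p ≠ 0) :
    pev (pderiv i (∏ k ∈ s, F k)) p =
      pev (∏ k ∈ s, F k) p * ∑ k ∈ s, pev (pderiv i (F k)) p / pev (F k) p := by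
  induction s using Finset.induction_on with
  | empty => simp [pev]
  | insert a s ha ih =>
    have h₁ := h a (Finset.mem_insert_self a s)
    have h₂ := ih fun k hk => h k (Finset.mem_insert_of_mem hk)
    simp only [pev] at h₁ h₂ ⊢
    rw [Finset.prod_insert ha, Finset.sum_insert ha, Derivation.leibniz]
    simp only [smul_eq_mul, map_add, map_mul, h₂]
    field_simp
    ring

lemma pev_muk (ctr : Fin n → ℝ × ℝ) (rad : Fin n → ℝ) (k : Fin n) (p : ℝ × ℝ)
    (h : pev (fk ctr rad k) p ≠ 0) :
    pev (muk ctr rad k) p = pev (Apoly ctr rad) p / pev (fk ctr rad k) p := by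
  rw [eq_div_iff h]
  simp only [pev, muk, Apoly, ← map_mul]
  rw [Finset.prod_erase_mul _ _ (Finset.mem_univ k)]

lemma pev_lamk (ctr : Fin n → ℝ × ℝ) (rad : Fin n → ℝ) (m : Fin n → ℕ) (k : Fin n) (p : ℝ × ℝ)
    (h : pev (fk ctr rad k) p ≠ 0) :
    pev (lamk ctr rad m k) p = pev (Am ctr rad m) p / pev (fk ctr rad k) p ^ m k := by
  rw [eq_div_iff (pow_ne_zero _ h)]
  simp only [pev, lamk, Am, ← map_mul, ← map_pow]
  rw [Finset.prod_erase_mul _ (fun k => fk ctr rad k ^ m k) (Finset.mem_univ k)]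

lemma Apoly_mul_prod_pow (ctr : Fin n → ℝ × ℝ) (rad : Fin n → ℝ) (m : Fin n → ℕ)
    (hm : ∀ k, 1 ≤ m k) :
    Apoly ctr rad * ∏ k, fk ctr rad k ^ (m k - 1) = Am ctr rad m := by
  rw [Apoly, Am, ← Finset.prod_mul_distrib]
  refine Finset.prod_congr rfl fun k _ => ?_
  rw [← pow_succ', Nat.sub_add_cancel (hm k)]

/-- Partial fraction decomposition of the `dy`-coefficient `P_{Tm} / (A_m B)`. -/
lemma pev_PTm_div (r : ℕ) (ctr : Fin n → ℝ × ℝ) (rad τ : Fin n → ℝ) (m : Fin n → ℕ)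
    (hm : ∀ k, 1 ≤ m k) (p : ℝ × ℝ)
    (hf : ∀ k, pev (fk ctr rad k) p ≠ 0) (hc : ∀ k, p ≠ ctr k) :
    pev (PTm r ctr rad τ m) p / (pev (Am ctr rad m) p * pev (Bpoly r ctr) p) =
      ∑ j ∈ Finset.univ.filter (fun j : Fin n => (j : ℕ) < r),
          2 * (p.1 - (ctr j).1) / pev (gpoly (ctr j)) p -
        ∑ j ∈ Finset.univ.filter (fun j : Fin n => (j : ℕ) < r),
          2 * (p.2 - (ctr j).2) / pev (gpoly (ctr j)) p -
        ∑ k, τ k * (2 * (p.2 - (ctr k).2) / pev (fk ctr rad k) p) -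
        Lam m * ∑ k, τ k * (2 * (p.2 - (ctr k).2) / pev (fk ctr rad k) p ^ m k) := by
  have hB : pev (Bpoly r ctr) p ≠ 0 := by
    simp only [pev, Bpoly, map_prod]
    exact Finset.prod_ne_zero_iff.2 fun k _ => pev_gpoly_ne_zero (hc k)
  have hA : pev (Am ctr rad m) p ≠ 0 := by
    simp only [pev, Am, map_prod, map_pow]
    exact Finset.prod_ne_zero_iff.2 fun k _ => pow_ne_zero _ (hf k)
  have hAm : pev (Apoly ctr rad) p * pev (∏ k, fk ctr rad k ^ (m k - 1)) p =
      pev (Am ctr rad m) p := by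
    rw [← Apoly_mul_prod_pow ctr rad m hm]; simp only [pev, map_mul]
  have hB0 := pev_pderiv_prod (Finset.univ.filter fun k : Fin n => (k : ℕ) < r)
    (fun k => gpoly (ctr k)) 0 p fun k _ => pev_gpoly_ne_zero (hc k)
  have hB1 := pev_pderiv_prod (Finset.univ.filter fun k : Fin n => (k : ℕ) < r)
    (fun k => gpoly (ctr k)) 1 p fun k _ => pev_gpoly_ne_zero (hc k)
  rw [← Bpoly] at hB0 hB1
  simp only [pev_pderiv_zero_gpoly, pev_pderiv_one_gpoly] at hB0 hB1
  have hμ : pev (∑ k, MvPolynomial.C (τ k) * muk ctr rad k * pderiv 1 (fk ctr rad k)) p =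
      pev (Apoly ctr rad) p * ∑ k, τ k * (2 * (p.2 - (ctr k).2) / pev (fk ctr rad k) p) := by
    rw [Finset.mul_sum, pev, map_sum]
    refine Finset.sum_congr rfl fun k _ => ?_
    have h₁ := pev_muk ctr rad k p (hf k)
    have h₂ := pev_pderiv_one_fpoly (ctr k) (rad k) p
    rw [← fk] at h₂
    simp only [pev, map_mul, eval_C] at h₁ h₂ ⊢
    rw [h₁, h₂]
    ring
  have hl : pev (FTm ctr rad τ m) p = Lam m * (pev (Am ctr rad m) p *
      ∑ k, τ k * (2 * (p.2 - (ctr k).2) / pev (fk ctr rad k) p ^ m k)) := by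
    rw [Finset.mul_sum, pev, FTm, map_mul, map_sum, eval_C]
    congr 1
    refine Finset.sum_congr rfl fun k _ => ?_
    have h₁ := pev_lamk ctr rad m k p (hf k)
    have h₂ := pev_pderiv_one_fpoly (ctr k) (rad k) p
    rw [← fk] at h₂
    simp only [pev, map_mul, eval_C] at h₁ h₂ ⊢
    rw [h₁, h₂]
    ring
  rw [div_eq_iff (mul_ne_zero hA hB)]
  have hP : pev (PTm r ctr rad τ m) p = (pev (Apoly ctr rad) p *
      (pev (pderiv 0 (Bpoly r ctr)) p - pev (pderiv 1 (Bpoly r ctr)) p) - pev (Bpoly r ctr) p *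
      pev (∑ k, MvPolynomial.C (τ k) * muk ctr rad k * pderiv 1 (fk ctr rad k)) p) *
      pev (∏ k, fk ctr rad k ^ (m k - 1)) p - pev (Bpoly r ctr) p * pev (FTm ctr rad τ m) p := by
    simp only [pev, PTm, PT, map_sub, map_mul]
  rw [hP, hB0, hB1, hμ, hl, ← hAm]
  ring

/-- Partial fraction decomposition of the `dx`-coefficient `Q_{Tm} / (A_m B)`. -/
lemma pev_QTm_div (r : ℕ) (ctr : Fin n → ℝ × ℝ) (rad τ : Fin n → ℝ) (m : Fin n → ℕ)
    (hm : ∀ k, 1 ≤ m k) (p : ℝ × ℝ)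
    (hf : ∀ k, pev (fk ctr rad k) p ≠ 0) (hc : ∀ k, p ≠ ctr k) :
    pev (QTm r ctr rad τ m) p / (pev (Am ctr rad m) p * pev (Bpoly r ctr) p) =
      ∑ j ∈ Finset.univ.filter (fun j : Fin n => (j : ℕ) < r),
          2 * (p.1 - (ctr j).1) / pev (gpoly (ctr j)) p +
        ∑ j ∈ Finset.univ.filter (fun j : Fin n => (j : ℕ) < r),
          2 * (p.2 - (ctr j).2) / pev (gpoly (ctr j)) p +
        ∑ k, τ k * (2 * (p.1 - (ctr k).1) / pev (fk ctr rad k) p) +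
        Lam m * ∑ k, τ k * (2 * (p.1 - (ctr k).1) / pev (fk ctr rad k) p ^ m k) := by
  have hB : pev (Bpoly r ctr) p ≠ 0 := by
    simp only [pev, Bpoly, map_prod]
    exact Finset.prod_ne_zero_iff.2 fun k _ => pev_gpoly_ne_zero (hc k)
  have hA : pev (Am ctr rad m) p ≠ 0 := by
    simp only [pev, Am, map_prod, map_pow]
    exact Finset.prod_ne_zero_iff.2 fun k _ => pow_ne_zero _ (hf k)
  have hAm : pev (Apoly ctr rad) p * pev (∏ k, fk ctr rad k ^ (m k - 1)) p =
      pev (Am ctr rad m) p := by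
    rw [← Apoly_mul_prod_pow ctr rad m hm]; simp only [pev, map_mul]
  have hB0 := pev_pderiv_prod (Finset.univ.filter fun k : Fin n => (k : ℕ) < r)
    (fun k => gpoly (ctr k)) 0 p fun k _ => pev_gpoly_ne_zero (hc k)
  have hB1 := pev_pderiv_prod (Finset.univ.filter fun k : Fin n => (k : ℕ) < r)
    (fun k => gpoly (ctr k)) 1 p fun k _ => pev_gpoly_ne_zero (hc k)
  rw [← Bpoly] at hB0 hB1
  simp only [pev_pderiv_zero_gpoly, pev_pderiv_one_gpoly] at hB0 hB1
  have hμ : pev (∑ k, MvPolynomial.C (τ k) * muk ctr rad k * pderiv 0 (fk ctr rad k)) p =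
      pev (Apoly ctr rad) p * ∑ k, τ k * (2 * (p.1 - (ctr k).1) / pev (fk ctr rad k) p) := by
    rw [Finset.mul_sum, pev, map_sum]
    refine Finset.sum_congr rfl fun k _ => ?_
    have h₁ := pev_muk ctr rad k p (hf k)
    have h₂ := pev_pderiv_zero_fpoly (ctr k) (rad k) p
    rw [← fk] at h₂
    simp only [pev, map_mul, eval_C] at h₁ h₂ ⊢
    rw [h₁, h₂]
    ring
  have hl : pev (GTm ctr rad τ m) p = Lam m * (pev (Am ctr rad m) p *
      ∑ k, τ k * (2 * (p.1 - (ctr k).1) / pev (fk ctr rad k) p ^ m k)) := by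
    rw [Finset.mul_sum, pev, GTm, map_mul, map_sum, eval_C]
    congr 1
    refine Finset.sum_congr rfl fun k _ => ?_
    have h₁ := pev_lamk ctr rad m k p (hf k)
    have h₂ := pev_pderiv_zero_fpoly (ctr k) (rad k) p
    rw [← fk] at h₂
    simp only [pev, map_mul, eval_C] at h₁ h₂ ⊢
    rw [h₁, h₂]
    ring
  rw [div_eq_iff (mul_ne_zero hA hB)]
  have hQ : pev (QTm r ctr rad τ m) p = (pev (Apoly ctr rad) p *
      (pev (pderiv 0 (Bpoly r ctr)) p + pev (pderiv 1 (Bpoly r ctr)) p) + pev (Bpoly r ctr) p *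
      pev (∑ k, MvPolynomial.C (τ k) * muk ctr rad k * pderiv 0 (fk ctr rad k)) p) *
      pev (∏ k, fk ctr rad k ^ (m k - 1)) p + pev (Bpoly r ctr) p * pev (GTm ctr rad τ m) p := by
    simp only [pev, QTm, QT, map_add, map_mul]
  rw [hQ, hB0, hB1, hμ, hl, ← hAm]
  ring

end Evaluation

/-- An exact form `φ' / φ ^ N` integrates to zero along a closed path on which `φ ≠ 0`. -/
lemma integral_deriv_div_pow_eq_zero {φ φ' : ℝ → ℝ} {a b : ℝ} (N : ℕ)
    (hφ : ∀ t ∈ uIcc a b, HasDerivAt φ (φ' t) t) (hφ' : ContinuousOn φ' (uIcc a b))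
    (h0 : ∀ t ∈ uIcc a b, φ t ≠ 0) (hab : φ a = φ b) :
    ∫ t in a..b, φ' t / φ t ^ N = 0 := by
  have hg : ContinuousOn (fun x : ℝ => (x ^ N)⁻¹) (φ '' uIcc a b) := by
    refine (continuousOn_id.pow N).inv₀ ?_
    rintro _ ⟨t, ht, rfl⟩
    exact pow_ne_zero N (h0 t ht)
  have h := intervalIntegral.integral_comp_mul_deriv' hφ hφ' hg
  rw [hab, intervalIntegral.integral_same] at h
  rw [← h]
  refine intervalIntegral.integral_congr fun t _ => ?_
  simp only [Function.comp_apply]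
  rw [div_eq_mul_inv, mul_comm]

/-- For any C¹ closed curve `γ = (u,v) : [0,1] → ℝ²` avoiding all circles
`C_k` and all centers `p_k`, the line integral of `ω_{Tm}/(A_m B) = (−Q_{Tm} dx + P_{Tm} dy)/(A_m B)`
along `γ` equals `2 Σ_{j=1}^r ∮ dθ_j`. -/
theorem line_integral_XTm
    (r : ℕ) (ctr : Fin n → ℝ × ℝ) (rad τ : Fin n → ℝ) (m : Fin n → ℕ)
    (hn : 1 ≤ n) (hrn : r ≤ n) (hrad : ∀ k, 0 < rad k)
    (hdisj : ∀ j k, j ≠ k → Disjoint (Ccir ctr rad j) (Ccir ctr rad k))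
    (hctr : ∀ j k, ctr j ∉ Ccir ctr rad k)
    (hprim : ∀ k, Primary ctr rad k ↔ (k : ℕ) < r)
    (hτ : ∀ k, 0 < τ k) (hm : ∀ k, 1 ≤ m k)
    (u v u' v' : ℝ → ℝ)
    (hu : ∀ t ∈ Set.Icc (0:ℝ) 1, HasDerivAt u (u' t) t)
    (hv : ∀ t ∈ Set.Icc (0:ℝ) 1, HasDerivAt v (v' t) t)
    (hu' : ContinuousOn u' (Set.Icc (0:ℝ) 1))
    (hv' : ContinuousOn v' (Set.Icc (0:ℝ) 1))
    (hclosed : u 0 = u 1 ∧ v 0 = v 1)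
    (havoid : ∀ t ∈ Set.Icc (0:ℝ) 1, ∀ k,
      pev (fk ctr rad k) (u t, v t) ≠ 0 ∧ (u t, v t) ≠ ctr k) :
    (∫ t in (0:ℝ)..1,
        (-(pev (QTm r ctr rad τ m) (u t, v t)) * u' t +
          pev (PTm r ctr rad τ m) (u t, v t) * v' t) /
          (pev (Am ctr rad m) (u t, v t) * pev (Bpoly r ctr) (u t, v t)))
      = 2 * ∑ j ∈ Finset.univ.filter (fun j : Fin n => (j : ℕ) < r),
          ∫ t in (0:ℝ)..1,
            ((u t - (ctr j).1) * v' t - (v t - (ctr j).2) * u' t) /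
              pev (gpoly (ctr j)) (u t, v t) := by
  have hI : uIcc (0 : ℝ) 1 = Icc 0 1 := uIcc_of_le zero_le_one
  rw [← hI] at hu hv hu' hv' havoid
  have huc : ContinuousOn u (uIcc 0 1) := fun t ht => (hu t ht).continuousAt.continuousWithinAt
  have hvc : ContinuousOn v (uIcc 0 1) := fun t ht => (hv t ht).continuousAt.continuousWithinAt
  set W : Fin n → ℝ → ℝ := fun k t =>
    2 * (u t - (ctr k).1) * u' t + 2 * (v t - (ctr k).2) * v' t with hW
  have hWc : ∀ k, ContinuousOn (W k) (uIcc 0 1) := fun k => by fun_prop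
  have hgc : ∀ k, ContinuousOn (fun t => pev (gpoly (ctr k)) (u t, v t)) (uIcc 0 1) := fun k => by
    simp only [pev_gpoly]; fun_prop
  have hfc : ∀ k, ContinuousOn (fun t => pev (fk ctr rad k) (u t, v t)) (uIcc 0 1) := fun k => by
    simp only [fk, pev_fpoly]; fun_prop
  have hgd : ∀ k, ∀ t ∈ uIcc (0 : ℝ) 1,
      HasDerivAt (fun t => pev (gpoly (ctr k)) (u t, v t)) (W k t) t := fun k t ht => by
    simp only [pev_gpoly]
    refine ((((hu t ht).sub_const (ctr k).1).pow 2).add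
      (((hv t ht).sub_const (ctr k).2).pow 2)).congr_deriv ?_
    simp [hW]
  have hfd : ∀ k, ∀ t ∈ uIcc (0 : ℝ) 1,
      HasDerivAt (fun t => pev (fk ctr rad k) (u t, v t)) (W k t) t := fun k t ht => by
    simpa only [fk, pev_fpoly, pev_gpoly] using (hgd k t ht).sub_const (rad k ^ 2)
  have hg0 : ∀ k, ∀ t ∈ uIcc (0 : ℝ) 1, pev (gpoly (ctr k)) (u t, v t) ≠ 0 :=
    fun k t ht => pev_gpoly_ne_zero (havoid t ht k).2
  have hf0 : ∀ k, ∀ t ∈ uIcc (0 : ℝ) 1, pev (fk ctr rad k) (u t, v t) ≠ 0 :=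
    fun k t ht => (havoid t ht k).1
  have hgz : ∀ k, ∫ t in (0 : ℝ)..1, W k t / pev (gpoly (ctr k)) (u t, v t) = 0 := fun k => by
    simpa using integral_deriv_div_pow_eq_zero 1 (hgd k) (hWc k) (hg0 k)
      (by simp only [hclosed.1, hclosed.2])
  have hfz : ∀ N k, ∫ t in (0 : ℝ)..1, W k t / pev (fk ctr rad k) (u t, v t) ^ N = 0 :=
    fun N k => integral_deriv_div_pow_eq_zero N (hfd k) (hWc k) (hf0 k)
      (by simp only [hclosed.1, hclosed.2])
  have hθi : ∀ k, IntervalIntegrable (fun t => ((u t - (ctr k).1) * v' t -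
      (v t - (ctr k).2) * u' t) / pev (gpoly (ctr k)) (u t, v t)) MeasureTheory.volume 0 1 :=
    fun k => (ContinuousOn.div (by fun_prop) (hgc k) (hg0 k)).intervalIntegrable
  have hgi : ∀ k, IntervalIntegrable (fun t => W k t / pev (gpoly (ctr k)) (u t, v t))
      MeasureTheory.volume 0 1 :=
    fun k => ((hWc k).div (hgc k) (hg0 k)).intervalIntegrable
  have hfi : ∀ N k, IntervalIntegrable (fun t => W k t / pev (fk ctr rad k) (u t, v t) ^ N)
      MeasureTheory.volume 0 1 := fun N k =>
    ((hWc k).div ((hfc k).pow N) fun t ht => pow_ne_zero N (hf0 k t ht)).intervalIntegrable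
  have key : ∀ t ∈ uIcc (0 : ℝ) 1,
      (-(pev (QTm r ctr rad τ m) (u t, v t)) * u' t +
          pev (PTm r ctr rad τ m) (u t, v t) * v' t) /
          (pev (Am ctr rad m) (u t, v t) * pev (Bpoly r ctr) (u t, v t)) =
        ∑ j ∈ Finset.univ.filter (fun j : Fin n => (j : ℕ) < r),
          (2 * (((u t - (ctr j).1) * v' t - (v t - (ctr j).2) * u' t) /
              pev (gpoly (ctr j)) (u t, v t)) - W j t / pev (gpoly (ctr j)) (u t, v t)) -
        ∑ k, (τ k * (W k t / pev (fk ctr rad k) (u t, v t) ^ 1) +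
          Lam m * τ k * (W k t / pev (fk ctr rad k) (u t, v t) ^ m k)) := fun t ht => by
    have hP := pev_PTm_div r ctr rad τ m hm (u t, v t) (fun k => hf0 k t ht)
      fun k => (havoid t ht k).2
    have hQ := pev_QTm_div r ctr rad τ m hm (u t, v t) (fun k => hf0 k t ht)
      fun k => (havoid t ht k).2
    rw [add_div, mul_div_right_comm, neg_div, mul_div_right_comm, hP, hQ]
    have e₁ : ∀ a b c d a' b' c' d' : ℝ,
        -(a + b + c + Lam m * d) * u' t + (a' - b' - c' - Lam m * d') * v' t =
        ((a' * v' t - b' * v' t) - (a * u' t + b * u' t)) -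
          ((c * u' t + c' * v' t) + (Lam m * (d * u' t) + Lam m * (d' * v' t))) := by
      intros; ring
    rw [e₁]
    simp only [Finset.sum_mul, Finset.mul_sum, ← Finset.sum_add_distrib, ← Finset.sum_sub_distrib]
    congr 1 <;> refine Finset.sum_congr rfl fun k _ => ?_ <;> simp only [hW] <;> ring
  rw [intervalIntegral.integral_congr key, intervalIntegral.integral_sub,
    intervalIntegral.integral_finsetSum, intervalIntegral.integral_finsetSum]
  · have h₁ : ∀ j, ∫ t in (0 : ℝ)..1,
        (2 * (((u t - (ctr j).1) * v' t - (v t - (ctr j).2) * u' t) /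
          pev (gpoly (ctr j)) (u t, v t)) - W j t / pev (gpoly (ctr j)) (u t, v t)) =
        2 * ∫ t in (0 : ℝ)..1, ((u t - (ctr j).1) * v' t - (v t - (ctr j).2) * u' t) /
          pev (gpoly (ctr j)) (u t, v t) := fun j => by
      rw [intervalIntegral.integral_sub ((hθi j).const_mul 2) (hgi j), hgz,
        intervalIntegral.integral_const_mul, sub_zero]
    have h₂ : ∀ k, ∫ t in (0 : ℝ)..1, (τ k * (W k t / pev (fk ctr rad k) (u t, v t) ^ 1) +
        Lam m * τ k * (W k t / pev (fk ctr rad k) (u t, v t) ^ m k)) = 0 := fun k => by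
      rw [intervalIntegral.integral_add ((hfi 1 k).const_mul _) ((hfi (m k) k).const_mul _),
        intervalIntegral.integral_const_mul, intervalIntegral.integral_const_mul, hfz, hfz]
      ring
    simp only [h₁, h₂, Finset.sum_const_zero, sub_zero, Finset.mul_sum]
  · exact fun k _ => ((hfi 1 k).const_mul _).add ((hfi (m k) k).const_mul _)
  · exact fun j _ => ((hθi j).const_mul 2).sub (hgi j)
  · simpa only [Finset.sum_fn] using IntervalIntegrable.sum _ fun j _ => ((hθi j).const_mul 2).sub (hgi j)
  · simpa only [Finset.sum_fn] using IntervalIntegrable.sum _ fun k _ => ((hfi 1 k).const_mul _).add ((hfi (m k) k).const_mul _)
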